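/- Let 𝒮 = ℂ[[x,y]]/(f) where f = f_1^{a_1}···f_t^{a_t} with f_i irreducible pairwise coprime, a_i ≥ 1, and minimal primes 𝔭_1,...,𝔭_t. Then the map G_0(𝒮) → ℤ^t sending [M] to (ℓ_{𝔭_1}(M_{𝔭_1}), ..., ℓ_{𝔭_t}(M_{𝔭_t})) is a group isomorphism, so G_0(𝒮) ≅ ℤ^t. Moreover, under this isomorphism the class [𝒮] maps to (a_1,...,a_t). -/

import Mathlib

universe u v

set_option synthInstance.maxHeartbeats 1000000
set_option maxHeartbeats 1000000

/-! ### The Grothendieck group `G₀` of finitely generated modules -/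

/-- A bundled finitely generated module over the commutative ring `R`. -/
structure FGMod (R : Type u) [CommRing R] : Type (u + 1) where
  carrier : Type u
  [isAddCommGroup : AddCommGroup carrier]
  [isModule : Module R carrier]
  [isFinite : Module.Finite R carrier]

attribute [instance] FGMod.isAddCommGroup FGMod.isModule FGMod.isFinite

/-- The bundled finitely generated module attached to a module. -/
def FGMod.of (R : Type u) [CommRing R] (M : Type u) [AddCommGroup M] [Module R M]
    [Module.Finite R M] : FGMod R :=
  ⟨M⟩

/-- The subgroup of relations coming from short exact sequences
`0 → A → B → C → 0` of finitely generated `R`-modules. -/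
def G0Rels (R : Type u) [CommRing R] : AddSubgroup (FreeAbelianGroup (FGMod R)) :=
  AddSubgroup.closure
    { x | ∃ (A B C : FGMod R) (f : A.carrier →ₗ[R] B.carrier) (g : B.carrier →ₗ[R] C.carrier),
        Function.Injective f ∧ Function.Surjective g ∧ LinearMap.range f = LinearMap.ker g ∧
        x = FreeAbelianGroup.of B - FreeAbelianGroup.of A - FreeAbelianGroup.of C }

/-- The Grothendieck group `G₀(R) = K₀(mod R)` of finitely generated `R`-modules:
the free abelian group on (finitely generated) modules modulo the relation
`[B] = [A] + [C]` for every short exact sequence `0 → A → B → C → 0`. -/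
def G0 (R : Type u) [CommRing R] : Type (u + 1) :=
  FreeAbelianGroup (FGMod R) ⧸ G0Rels R

noncomputable instance (R : Type u) [CommRing R] : AddCommGroup (G0 R) :=
  inferInstanceAs (AddCommGroup (FreeAbelianGroup (FGMod R) ⧸ G0Rels R))

/-- The class `[M]` of a finitely generated module in the Grothendieck group `G₀(R)`. -/
def G0.mk {R : Type u} [CommRing R] (M : FGMod R) : G0 R :=
  QuotientAddGroup.mk (FreeAbelianGroup.of M)

/-- In a module over a noetherian ring, every submodule of a finitely generated module is
finitely generated. -/
instance (R : Type u) [CommRing R] [IsNoetherianRing R] (M : Type u) [AddCommGroup M]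
    [Module R M] [Module.Finite R M] (N : Submodule R M) : Module.Finite R ↥N := by
  haveI : IsNoetherian R M := isNoetherian_of_isNoetherianRing_of_finite R M
  exact Module.Finite.iff_fg.mpr (IsNoetherian.noetherian N)

/-- The length of an `R`-module `M`: the supremum of the lengths of chains of submodules,
i.e. the Krull dimension of the lattice of submodules of `M`. -/
noncomputable def modLength (R : Type u) [CommRing R] (M : Type v) [AddCommGroup M]
    [Module R M] : WithBot ℕ∞ :=
  Order.krullDim (Submodule R M)

/-- The principal ideal `(f₁^{a₁} ⋯ f_t^{a_t})` of the formal power series ring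
`ℂ[[x,y]]`, where the `fᵢ ∈ ℂ[[x,y]]` are power series in the two variables indexed by
`Fin 2`. -/
noncomputable def psIdeal (t : ℕ) (f : Fin t → MvPowerSeries (Fin 2) ℂ)
    (a : Fin t → ℕ) : Ideal (MvPowerSeries (Fin 2) ℂ) :=
  Ideal.span {∏ i, f i ^ a i}

/-- The ring `𝒮 = ℂ[[x,y]]/(f₁^{a₁} ⋯ f_t^{a_t})`. -/
abbrev PSRing (t : ℕ) (f : Fin t → MvPowerSeries (Fin 2) ℂ) (a : Fin t → ℕ) : Type :=
  MvPowerSeries (Fin 2) ℂ ⧸ psIdeal t f a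

/-- The ideal `𝔭ᵢ = (fᵢ)/(f)` of `𝒮 = ℂ[[x,y]]/(f)`. -/
noncomputable def psPrime (t : ℕ) (f : Fin t → MvPowerSeries (Fin 2) ℂ)
    (a : Fin t → ℕ) (i : Fin t) : Ideal (PSRing t f a) :=
  Ideal.span {Ideal.Quotient.mk (psIdeal t f a) (f i)}


namespace G0Aux

theorem mk_exact {R : Type u} [CommRing R] (A B C : FGMod R)
    (f : A.carrier →ₗ[R] B.carrier) (g : B.carrier →ₗ[R] C.carrier)
    (hf : Function.Injective f) (hg : Function.Surjective g)
    (h : LinearMap.range f = LinearMap.ker g) :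
    G0.mk B = G0.mk A + G0.mk C := by
  have h1 : FreeAbelianGroup.of B - FreeAbelianGroup.of A - FreeAbelianGroup.of C ∈ G0Rels R :=
    AddSubgroup.subset_closure ⟨A, B, C, f, g, hf, hg, h, rfl⟩
  have h2 : (QuotientAddGroup.mk (FreeAbelianGroup.of B - FreeAbelianGroup.of A -
      FreeAbelianGroup.of C) : FreeAbelianGroup (FGMod R) ⧸ G0Rels R) = 0 :=
    (QuotientAddGroup.eq_zero_iff _).2 h1
  have h3 : G0.mk B - G0.mk A - G0.mk C = 0 := h2
  rw [sub_sub, sub_eq_zero] at h3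
  exact h3

theorem mk_exact' {R : Type u} [CommRing R] (A B C : Type u)
    [AddCommGroup A] [Module R A] [Module.Finite R A]
    [AddCommGroup B] [Module R B] [Module.Finite R B]
    [AddCommGroup C] [Module R C] [Module.Finite R C]
    (f : A →ₗ[R] B) (g : B →ₗ[R] C)
    (hf : Function.Injective f) (hg : Function.Surjective g)
    (h : Function.Exact f g) :
    G0.mk (FGMod.of R B) = G0.mk (FGMod.of R A) + G0.mk (FGMod.of R C) :=
  mk_exact (FGMod.of R A) (FGMod.of R B) (FGMod.of R C) f g hf hg (LinearMap.exact_iff.1 h).symm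

theorem mk_subsingleton {R : Type u} [CommRing R] (A : Type u)
    [AddCommGroup A] [Module R A] [Module.Finite R A] [Subsingleton A] :
    G0.mk (FGMod.of R A) = 0 := by
  have := mk_exact' (R := R) A A A 0 0 (Function.injective_of_subsingleton _)
    (Function.surjective_to_subsingleton _) (fun x => by
      simp [Subsingleton.elim x 0])
  simpa using this

theorem mk_equiv {R : Type u} [CommRing R] (A B : Type u)
    [AddCommGroup A] [Module R A] [Module.Finite R A]
    [AddCommGroup B] [Module R B] [Module.Finite R B] (e : A ≃ₗ[R] B) :
    G0.mk (FGMod.of R A) = G0.mk (FGMod.of R B) := by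
  have := mk_exact' (R := R) A B PUnit.{u+1} e.toLinearMap 0 e.injective
    (Function.surjective_to_subsingleton _)
    ((e.exact_zero_iff_surjective _).2 e.surjective)
  rw [mk_subsingleton PUnit.{u+1}, add_zero] at this
  exact this.symm

theorem exists_lift {R : Type u} [CommRing R] {G : Type v} [AddCommGroup G] (φ : FGMod R → G)
    (hφ : ∀ (A B C : FGMod R) (f : A.carrier →ₗ[R] B.carrier) (g : B.carrier →ₗ[R] C.carrier),
      Function.Injective f → Function.Surjective g → Function.Exact f g → φ B = φ A + φ C) :
    ∃ ρ : G0 R →+ G, ∀ M, ρ (G0.mk M) = φ M := by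
  have key : G0Rels R ≤ (FreeAbelianGroup.lift φ).ker := by
    unfold G0Rels
    rw [AddSubgroup.closure_le]
    rintro x ⟨A, B, C, f, g, hf, hg, h, rfl⟩
    have := hφ A B C f g hf hg (LinearMap.exact_iff.2 h.symm)
    simp [AddMonoidHom.mem_ker, this]
  refine ⟨QuotientAddGroup.lift (G0Rels R) (FreeAbelianGroup.lift φ) key, fun M => ?_⟩
  have := QuotientAddGroup.lift_mk (G0Rels R) key (FreeAbelianGroup.of M)
  refine this.trans ?_
  simp

theorem closure_mk {R : Type u} [CommRing R] (H : AddSubgroup (G0 R))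
    (h : ∀ M : FGMod R, G0.mk M ∈ H) : H = ⊤ := by
  rw [eq_top_iff]
  rintro x -
  obtain ⟨y, rfl⟩ := QuotientAddGroup.mk_surjective x
  induction y using FreeAbelianGroup.induction_on with
  | zero => exact H.zero_mem
  | of M => exact h M
  | neg M hM => exact H.neg_mem hM
  | add a b ha hb => exact H.add_mem ha hb

theorem mk_mem_of_primes {R : Type u} [CommRing R] [IsNoetherianRing R] (H : AddSubgroup (G0 R))
    (h : ∀ q : Ideal R, q.IsPrime → G0.mk (FGMod.of R (R ⧸ q)) ∈ H) : H = ⊤ := by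
  refine closure_mk H fun M => ?_
  have := IsNoetherianRing.induction_on_isQuotientEquivQuotientPrime (A := R)
    (M := M.carrier) inferInstance
    (motive := fun N _ _ _ => G0.mk (FGMod.of R N) ∈ H)
    (fun N _ _ _ _ => by rw [mk_subsingleton]; exact H.zero_mem)
    (fun N _ _ _ p e => by rw [mk_equiv N (R ⧸ p.1) e]; exact h p.1 p.2)
    (fun N₁ _ _ _ N₂ _ _ _ N₃ _ _ _ f g hf hg hfg h1 h3 => by
      rw [mk_exact' N₁ N₂ N₃ f g hf hg hfg]; exact H.add_mem h1 h3)
  exact this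

/-- localization at a minimal prime is artinian -/
theorem artinian_loc {R : Type u} [CommRing R] [IsNoetherianRing R] (p : Ideal R) [p.IsPrime]
    (hmin : ∀ q : Ideal R, q.IsPrime → q ≤ p → q = p) :
    IsArtinianRing (Localization p.primeCompl) := by
  have : IsNoetherianRing (Localization p.primeCompl) :=
    IsLocalization.isNoetherianRing p.primeCompl _ inferInstance
  have : Ring.KrullDimLE 0 (Localization p.primeCompl) := by
    rw [Ring.krullDimLE_zero_iff]
    intro I hI
    have h1 := (IsLocalization.isPrime_iff_isPrime_disjoint p.primeCompl
      (Localization p.primeCompl) I).1 hI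
    have h2 : Ideal.comap (algebraMap R (Localization p.primeCompl)) I ≤ p := by
      intro x hx
      by_contra hxp
      exact Set.disjoint_left.1 h1.2 hxp hx
    have h3 := hmin _ h1.1 h2
    have h4 : I = IsLocalRing.maximalIdeal (Localization.AtPrime p) := by
      rw [← IsLocalization.map_under p.primeCompl (Localization p.primeCompl) I, h3]
      exact Localization.AtPrime.map_eq_maximalIdeal
    rw [h4]
    exact IsLocalRing.maximalIdeal.isMaximal (Localization.AtPrime p)
  exact IsNoetherianRing.isArtinianRing_of_krullDimLE_zero

/-- length at a prime, as an integer -/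
noncomputable def locLen {R : Type u} [CommRing R] (p : Ideal R) [p.IsPrime] (M : Type u)
    [AddCommGroup M] [Module R M] : ℕ :=
  (Module.length (Localization p.primeCompl) (LocalizedModule p.primeCompl M)).toNat

section
variable {R : Type u} [CommRing R] [IsNoetherianRing R] (p : Ideal R) [p.IsPrime]

theorem length_eq_locLen
    (hmin : ∀ q : Ideal R, q.IsPrime → q ≤ p → q = p)
    (M : Type u) [AddCommGroup M] [Module R M] [Module.Finite R M] :
    Module.length (Localization p.primeCompl) (LocalizedModule p.primeCompl M) = locLen p M := by
  have := artinian_loc p hmin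
  have : Module.Finite (Localization p.primeCompl) (LocalizedModule p.primeCompl M) :=
    Module.Finite.of_isLocalizedModule p.primeCompl (LocalizedModule.mkLinearMap p.primeCompl M)
  have h : Module.length (Localization p.primeCompl) (LocalizedModule p.primeCompl M) ≠ ⊤ :=
    Module.length_ne_top
  exact (ENat.natCast_toNat h).symm

theorem locLen_exact
    (hmin : ∀ q : Ideal R, q.IsPrime → q ≤ p → q = p)
    (A B C : Type u)
    [AddCommGroup A] [Module R A] [Module.Finite R A]
    [AddCommGroup B] [Module R B] [Module.Finite R B]
    [AddCommGroup C] [Module R C] [Module.Finite R C]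
    (f : A →ₗ[R] B) (g : B →ₗ[R] C)
    (hf : Function.Injective f) (hg : Function.Surjective g)
    (h : Function.Exact f g) : locLen p B = locLen p A + locLen p C := by
  have := Module.length_eq_add_of_exact (LocalizedModule.map p.primeCompl f)
    (LocalizedModule.map p.primeCompl g) (LocalizedModule.map_injective p.primeCompl f hf)
    (LocalizedModule.map_surjective p.primeCompl g hg)
    (LocalizedModule.map_exact p.primeCompl f g h)
  rw [length_eq_locLen p hmin, length_eq_locLen p hmin, length_eq_locLen p hmin] at this
  exact_mod_cast this

theorem locLen_self
    (hmin : ∀ q : Ideal R, q.IsPrime → q ≤ p → q = p)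
    : locLen p (R ⧸ p) = 1 := by
  suffices h : Module.length (Localization p.primeCompl) (LocalizedModule p.primeCompl (R ⧸ p)) = 1 by
    rw [length_eq_locLen p hmin] at h
    exact_mod_cast h
  rw [Module.length_eq_one_iff]
  rw [isSimpleModule_iff_toSpanSingleton_surjective]
  constructor
  · refine ⟨LocalizedModule.mk (Ideal.Quotient.mk p 1) 1, 0, fun h0 => ?_⟩
    rw [← LocalizedModule.zero_mk 1, LocalizedModule.mk_eq] at h0
    obtain ⟨c, hc⟩ := h0
    simp only [one_smul, smul_zero] at hc
    have h1 : Ideal.Quotient.mk p (c.1 * 1) = 0 := hc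
    rw [Ideal.Quotient.eq_zero_iff_mem, mul_one] at h1
    exact c.2 h1
  · intro m hm y
    induction m using LocalizedModule.induction_on with
    | _ m s =>
    induction y using LocalizedModule.induction_on with
    | _ m' s' =>
    obtain ⟨r, rfl⟩ := Ideal.Quotient.mk_surjective m
    obtain ⟨r', rfl⟩ := Ideal.Quotient.mk_surjective m'
    have hr : r ∉ p := by
      intro hr
      rw [Ideal.Quotient.eq_zero_iff_mem.2 hr] at hm
      exact hm (LocalizedModule.zero_mk s)
    refine ⟨Localization.mk (s.1 * r') (⟨r, hr⟩ * s'), ?_⟩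
    rw [LinearMap.toSpanSingleton_apply, LocalizedModule.mk_smul_mk, LocalizedModule.mk_eq]
    refine ⟨1, ?_⟩
    simp only [one_smul]
    change Ideal.Quotient.mk p (s'.1 * ((s.1 * r') * r)) =
      Ideal.Quotient.mk p (((r * s'.1) * s.1) * r')
    congr 1
    ring

end

theorem locLen_other {R : Type u} [CommRing R] (p q : Ideal R) [p.IsPrime] (h : ¬ q ≤ p) :
    locLen p (R ⧸ q) = 0 := by
  obtain ⟨x, hxq, hxp⟩ := SetLike.not_le_iff_exists.1 h
  have : Subsingleton (LocalizedModule p.primeCompl (R ⧸ q)) := by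
    rw [LocalizedModule.subsingleton_iff]
    intro m
    refine ⟨x, hxp, ?_⟩
    obtain ⟨m, rfl⟩ := Ideal.Quotient.mk_surjective m
    rw [← Ideal.Quotient.mk_eq_mk, ← Submodule.Quotient.mk_smul, Submodule.Quotient.mk_eq_zero]
    exact Ideal.mul_mem_right _ _ hxq
  simp [locLen, Module.length_eq_zero]

theorem main_abstract {R : Type u} [CommRing R] [IsNoetherianRing R] (t : ℕ)
    (p : Fin t → Ideal R) (hp : ∀ i, (p i).IsPrime)
    (hmin : ∀ i, ∀ q : Ideal R, q.IsPrime → q ≤ p i → q = p i)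
    (hinj : Function.Injective p)
    (hother : ∀ q : Ideal R, q.IsPrime → (∃ i, q = p i) ∨ G0.mk (FGMod.of R (R ⧸ q)) = 0) :
    ∃ ρ : G0 R →+ (Fin t → ℤ),
      (∀ (M : FGMod R) (i : Fin t), ∃ m : ℕ,
          ρ (G0.mk M) i = (m : ℤ) ∧
          modLength (Localization (@Ideal.primeCompl _ _ (p i) (hp i)))
              (LocalizedModule (@Ideal.primeCompl _ _ (p i) (hp i))
                M.carrier) =
            ((m : ℕ∞) : WithBot ℕ∞)) ∧
      Function.Bijective ρ ∧
      ∀ j, ρ (G0.mk (FGMod.of R (R ⧸ p j))) = Pi.single j 1 := by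
  obtain ⟨ρ, hρ⟩ := exists_lift (R := R) (fun M (i : Fin t) => (locLen (p i) M.carrier : ℤ))
    (fun A B C f g hf hg h => by
      funext i
      have := locLen_exact (p i) (hmin i) A.carrier B.carrier C.carrier f g hf hg h
      simp [this])
  have hsing : ∀ j, ρ (G0.mk (FGMod.of R (R ⧸ p j))) = Pi.single j 1 := by
    intro j
    rw [hρ]
    funext i
    by_cases hij : i = j
    · subst hij
      have := locLen_self (p i) (hmin i)
      change ((locLen (p i) (R ⧸ p i) : ℕ) : ℤ) = _
      simp [this]
    · have := locLen_other (p i) (p j) (fun hle => hij (hinj (hmin i _ (hp j) hle).symm))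
      change ((locLen (p i) (R ⧸ p j) : ℕ) : ℤ) = _
      simp [Pi.single_apply, hij, this]
  refine ⟨ρ, ?_, ?_, hsing⟩
  · intro M i
    refine ⟨locLen (p i) M.carrier, by rw [hρ], ?_⟩
    rw [← length_eq_locLen (p i) (hmin i), Module.coe_length]
    rfl
  · let σ : (Fin t → ℤ) →+ G0 R :=
      { toFun := fun v => ∑ j, v j • G0.mk (FGMod.of R (R ⧸ p j))
        map_zero' := by simp
        map_add' := fun v w => by simp [add_smul, Finset.sum_add_distrib] }
    have hσ : ∀ v, σ v = ∑ j, v j • G0.mk (FGMod.of R (R ⧸ p j)) := fun _ => rfl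
    have h1 : ∀ v, ρ (σ v) = v := by
      intro v
      rw [hσ, map_sum]
      simp only [map_zsmul, hsing]
      funext i
      simp [Finset.sum_apply, Pi.single_apply]
    have h2 : σ.range = ⊤ := by
      refine mk_mem_of_primes _ fun q hq => ?_
      rcases hother q hq with ⟨i, rfl⟩ | h
      · refine ⟨Pi.single i 1, ?_⟩
        rw [hσ]
        simp [Pi.single_apply]
      · rw [h]; exact zero_mem _
    refine ⟨?_, fun v => ⟨σ v, h1 v⟩⟩
    intro x y hxy
    have hx : x ∈ σ.range := by rw [h2]; trivial
    have hy : y ∈ σ.range := by rw [h2]; trivial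
    obtain ⟨v, rfl⟩ := hx
    obtain ⟨w, rfl⟩ := hy
    rw [h1, h1] at hxy
    rw [hxy]

end G0Aux

namespace G0Aux
open PowerSeries

/-- A normalization argument: a finite domain over a DVR with algebraically closed residue field
maps finitely to a PID with a principal maximal ideal having the same residue field. -/
theorem exists_normalization {A D : Type} [CommRing A] [IsDomain A] [IsDiscreteValuationRing A]
    [CharZero A] [IsAlgClosed (IsLocalRing.ResidueField A)]
    [CommRing D] [IsDomain D] [Algebra A D] [Module.Finite A D]
    (hinj : Function.Injective (algebraMap A D)) :
    ∃ (B : Type) (_ : CommRing B) (_ : IsDomain B) (φ : D →+* B) (π : B), φ.Finite ∧ π ≠ 0 ∧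
      (Ideal.span {π}).IsMaximal ∧
      Function.Surjective ((Ideal.Quotient.mk (Ideal.span {π})).comp φ) := by
  have : FaithfulSMul A D := (faithfulSMul_iff_algebraMap_injective A D).2 hinj
  let K := FractionRing A
  let L := FractionRing D
  have : CharZero K := charZero_of_injective_algebraMap (IsFractionRing.injective A K)
  letI : Algebra K L := FractionRing.liftAlgebra A L
  have : IsScalarTower A K L := FractionRing.isScalarTower_liftAlgebra A L
  have : FiniteDimensional K L := inferInstance
  let B := integralClosure A L
  have hBfin : Module.Finite A B := IsIntegralClosure.finite A K L B
  have : IsDedekindDomain B := integralClosure.isDedekindDomain A K L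
  let φ : D →ₐ[A] B := (IsScalarTower.toAlgHom A D L).codRestrict (integralClosure A L)
    (fun d => (Algebra.IsIntegral.isIntegral (R := A) d).map (IsScalarTower.toAlgHom A D L))
  have hAB : Function.Injective (algebraMap A B) := by
    intro x y hxy
    have := congrArg (algebraMap B L) hxy
    rw [← IsScalarTower.algebraMap_apply, ← IsScalarTower.algebraMap_apply] at this
    rw [IsScalarTower.algebraMap_apply A D L, IsScalarTower.algebraMap_apply A D L] at this
    exact hinj (IsFractionRing.injective D L this)
  have : FaithfulSMul A B := (faithfulSMul_iff_algebraMap_injective A B).2 hAB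
  have hprimes : ∀ P : Ideal B, P.IsPrime → P = ⊥ ∨
      P ∈ (IsLocalRing.maximalIdeal A).primesOver B := by
    intro P hP
    by_cases hP0 : P = ⊥
    · exact Or.inl hP0
    right
    refine ⟨hP, ⟨?_⟩⟩
    have h1 : P.IsMaximal := hP.isMaximal hP0
    have h2 : (P.under A).IsMaximal := Ideal.isMaximal_comap_of_isIntegral_of_isMaximal P
    exact (IsLocalRing.eq_maximalIdeal h2).symm
  have hfin : {I : Ideal B | I.IsPrime}.Finite := by
    refine ((IsDedekindDomain.primesOver_finite (IsLocalRing.maximalIdeal A) B).union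
      (Set.finite_singleton ⊥)).subset ?_
    intro P hP
    rcases hprimes P hP with h | h
    · exact Or.inr h
    · exact Or.inl h
  have hPID : IsPrincipalIdealRing B := IsPrincipalIdealRing.of_finite_primes hfin
  obtain ⟨P, hPmax, hPover⟩ := Ideal.exists_maximal_ideal_liesOver_of_isIntegral (S := B)
    (IsLocalRing.maximalIdeal A)
  obtain ⟨π, hπ⟩ := (hPID.principal P).principal
  have hπ' : P = Ideal.span {π} := hπ
  subst hπ'
  refine ⟨B, inferInstance, inferInstance, φ.toRingHom, π, ?_, ?_, hPmax, ?_⟩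
  · have h : (φ.toRingHom.comp (algebraMap A D)).Finite := by
      have : φ.toRingHom.comp (algebraMap A D) = algebraMap A B := φ.comp_algebraMap
      rw [this]
      exact RingHom.finite_algebraMap.2 hBfin
    exact RingHom.Finite.of_comp_finite h
  · rintro rfl
    have h1 := hPover.over
    have h2 : IsLocalRing.maximalIdeal A = ⊥ := by
      rw [h1, eq_bot_iff]
      intro x hx
      rw [Ideal.mem_comap, Ideal.span_singleton_zero, Ideal.mem_bot] at hx
      exact hAB (hx.trans (map_zero _).symm)
    exact IsDiscreteValuationRing.not_a_field A h2
  · letI : Field (B ⧸ Ideal.span {π}) := Ideal.Quotient.field _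
    letI : Algebra (A ⧸ IsLocalRing.maximalIdeal A) (B ⧸ Ideal.span {π}) := inferInstance
    have : Algebra.IsIntegral (A ⧸ IsLocalRing.maximalIdeal A) (B ⧸ Ideal.span {π}) := inferInstance
    have hb := IsAlgClosed.algebraMap_bijective_of_isIntegral
      (k := IsLocalRing.ResidueField A) (K := B ⧸ Ideal.span {π})
    intro y
    obtain ⟨x, rfl⟩ := hb.2 y
    obtain ⟨x, rfl⟩ := Ideal.Quotient.mk_surjective x
    refine ⟨algebraMap A D x, ?_⟩
    change Ideal.Quotient.mk _ (φ (algebraMap A D x)) = _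
    rw [φ.commutes]
    rfl
end G0Aux

namespace G0Aux
open PowerSeries

theorem maxIdeal_A : IsLocalRing.maximalIdeal ℂ⟦X⟧ = Ideal.span {X} :=
  PowerSeries.maximalIdeal_eq_span_X

theorem adicA : IsAdicComplete (IsLocalRing.maximalIdeal ℂ⟦X⟧) ℂ⟦X⟧ := by
  rw [maxIdeal_A]; infer_instance

theorem algClosedA : IsAlgClosed (IsLocalRing.ResidueField ℂ⟦X⟧) :=
  IsAlgClosed.of_ringEquiv ℂ _ (residueFieldOfPowerSeries (k := ℂ)).symm

/-- the maximal ideal of `ℂ⟦x⟧⟦y⟧` -/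
theorem maxIdeal_P : IsLocalRing.maximalIdeal (ℂ⟦X⟧⟦X⟧) = Ideal.span {X, C X} := by
  apply le_antisymm
  · intro p hp
    have h0 : ¬ IsUnit (constantCoeff p) := by
      rw [← PowerSeries.isUnit_iff_constantCoeff]
      exact (IsLocalRing.mem_maximalIdeal p).1 hp
    have h1 : constantCoeff p ∈ IsLocalRing.maximalIdeal ℂ⟦X⟧ := h0
    rw [maxIdeal_A, Ideal.mem_span_singleton] at h1
    obtain ⟨r, hr⟩ := h1
    have h2 : X ∣ p - C (constantCoeff p) := by
      rw [X_dvd_iff]; simp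
    obtain ⟨q, hq⟩ := h2
    rw [Ideal.mem_span_pair]
    refine ⟨q, C r, ?_⟩
    rw [sub_eq_iff_eq_add] at hq
    rw [hq, hr, map_mul]
    ring
  · rw [Ideal.span_le]
    rintro x (rfl | rfl)
    · rw [SetLike.mem_coe, IsLocalRing.mem_maximalIdeal, mem_nonunits_iff,
        PowerSeries.isUnit_iff_constantCoeff]
      simp
    · rw [SetLike.mem_coe, IsLocalRing.mem_maximalIdeal, mem_nonunits_iff,
        PowerSeries.isUnit_iff_constantCoeff]
      simp [PowerSeries.isUnit_iff_constantCoeff]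

theorem primes_P (g : ℂ⟦X⟧⟦X⟧) (hg : Prime g) (q : Ideal ℂ⟦X⟧⟦X⟧) (hq : q.IsPrime)
    (hgq : g ∈ q) : q = Ideal.span {g} ∨ q = IsLocalRing.maximalIdeal (ℂ⟦X⟧⟦X⟧) := by
  by_contra! hcon
  have hgp : (Ideal.span {g}).IsPrime := (Ideal.span_singleton_prime hg.ne_zero).2 hg
  have h1 : (⊥ : Ideal ℂ⟦X⟧⟦X⟧) < Ideal.span {g} :=
    bot_lt_iff_ne_bot.2 (by simpa using hg.ne_zero)
  have h2 : Ideal.span {g} < q :=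
    lt_of_le_of_ne ((Ideal.span_singleton_le_iff_mem _).2 hgq) hcon.1.symm
  have h3 : q < IsLocalRing.maximalIdeal (ℂ⟦X⟧⟦X⟧) :=
    lt_of_le_of_ne (IsLocalRing.le_maximalIdeal hq.ne_top) hcon.2
  have k1 := Ideal.height_add_one_le_of_lt_of_isPrime h1
  have k2 := Ideal.height_add_one_le_of_lt_of_isPrime h2
  have k3 := Ideal.height_add_one_le_of_lt_of_isPrime h3
  have hle : (IsLocalRing.maximalIdeal (ℂ⟦X⟧⟦X⟧)).height ≤ 2 := by
    refine (Ideal.height_le_spanFinrank _ (Ideal.IsPrime.ne_top')).trans ?_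
    have h5 : (IsLocalRing.maximalIdeal (ℂ⟦X⟧⟦X⟧)).spanFinrank ≤ 2 := by
      rw [maxIdeal_P]
      refine (Submodule.spanFinrank_span_le_ncard_of_finite (by simp)).trans ?_
      refine (Set.ncard_insert_le _ _).trans ?_
      rw [Set.ncard_singleton]
    exact_mod_cast h5
  have : (3 : ℕ∞) ≤ 2 := by
    refine le_trans ?_ hle
    refine le_trans ?_ k3
    refine le_trans ?_ (add_le_add_left k2 1)
    refine le_trans ?_ (add_le_add_left (add_le_add_left k1 1) 1)
    rw [add_assoc, add_assoc]
    refine le_trans ?_ le_add_self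
    norm_num
  exact absurd this (by norm_num)

theorem CX_dvd (h : ℂ⟦X⟧⟦X⟧) (hh : ∀ n, X ∣ coeff n h) : (C X : ℂ⟦X⟧⟦X⟧) ∣ h := by
  choose c hc using hh
  refine ⟨PowerSeries.mk c, ?_⟩
  ext1 n
  rw [hc n, coeff_C_mul, coeff_mk]

theorem CX_ne_zero : (C X : ℂ⟦X⟧⟦X⟧) ≠ 0 := by
  intro h
  have h1 := congrArg constantCoeff h
  rw [constantCoeff_C, map_zero] at h1
  exact X_ne_zero h1

theorem CX_not_unit : ¬ IsUnit (C X : ℂ⟦X⟧⟦X⟧) := by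
  rw [PowerSeries.isUnit_iff_constantCoeff, constantCoeff_C,
    PowerSeries.isUnit_iff_constantCoeff]
  simp

theorem exists_norm_P (g : ℂ⟦X⟧⟦X⟧) (hg : Prime g) :
    ∃ (B : Type) (_ : CommRing B) (_ : IsDomain B) (φ : ℂ⟦X⟧⟦X⟧ →+* B) (π : B),
      φ.Finite ∧ φ g = 0 ∧ π ≠ 0 ∧
      (Ideal.span {π}).IsMaximal ∧
      Function.Surjective ((Ideal.Quotient.mk (Ideal.span {π})).comp φ) := by
  have hgp : (Ideal.span {g}).IsPrime := (Ideal.span_singleton_prime hg.ne_zero).2 hg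
  have := adicA
  have := algClosedA
  by_cases hX : (C X : ℂ⟦X⟧⟦X⟧) ∈ Ideal.span {g}
  · -- then `(g) = (x)` and the quotient is `ℂ⟦y⟧`
    let φ : ℂ⟦X⟧⟦X⟧ →+* ℂ⟦X⟧ := PowerSeries.map (constantCoeff (R := ℂ))
    have hφs : Function.Surjective φ := by
      intro y
      refine ⟨PowerSeries.map (C (R := ℂ)) y, ?_⟩
      ext n
      simp [φ]
    have hπmax : (Ideal.span {(X : ℂ⟦X⟧)}).IsMaximal := by
      rw [← maxIdeal_A]; infer_instance
    refine ⟨ℂ⟦X⟧, inferInstance, inferInstance, φ, X, RingHom.Finite.of_surjective _ hφs, ?_,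
      X_ne_zero, hπmax, ?_⟩
    · obtain ⟨h, hh⟩ := Ideal.mem_span_singleton.1 hX
      have h0 : φ g * φ h = 0 := by
        rw [← map_mul, ← hh]
        simp [φ]
      rcases mul_eq_zero.1 h0 with h1 | h1
      · exact h1
      · exfalso
        have h2 : (C X : ℂ⟦X⟧⟦X⟧) ∣ h := by
          apply CX_dvd
          intro n
          rw [X_dvd_iff]
          have := congrArg (coeff n) h1
          simpa [φ] using this
        obtain ⟨k, rfl⟩ := h2
        apply hg.not_unit
        refine IsUnit.of_mul_eq_one k ?_
        apply mul_left_cancel₀ CX_ne_zero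
        rw [mul_one]
        conv_rhs => rw [hh]
        ring
    · rw [RingHom.coe_comp]
      exact Ideal.Quotient.mk_surjective.comp hφs
  · have hmap : g.map (IsLocalRing.residue ℂ⟦X⟧) ≠ 0 := by
      intro h0
      have h2 : (C X : ℂ⟦X⟧⟦X⟧) ∣ g := by
        apply CX_dvd
        intro n
        have h3 := congrArg (coeff n) h0
        rw [coeff_map, map_zero, IsLocalRing.residue_eq_zero_iff, maxIdeal_A,
          Ideal.mem_span_singleton] at h3
        exact h3
      obtain ⟨k, hk⟩ := h2
      rcases hg.irreducible.isUnit_or_isUnit hk with h4 | h4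
      · exact CX_not_unit h4
      · apply hX
        rw [Ideal.mem_span_singleton, hk]
        exact (associated_mul_unit_left _ _ h4).dvd
    obtain ⟨D, _, _, mk, hmks, hmk⟩ : ∃ (D : Type) (_ : CommRing D) (_ : IsDomain D)
        (mk : ℂ⟦X⟧⟦X⟧ →+* D), Function.Surjective mk ∧ ∀ p, mk p = 0 ↔ p ∈ Ideal.span {g} :=
      ⟨ℂ⟦X⟧⟦X⟧ ⧸ Ideal.span {g}, inferInstance, inferInstance, Ideal.Quotient.mk _,
        Ideal.Quotient.mk_surjective, fun p => Ideal.Quotient.eq_zero_iff_mem⟩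
    letI : Algebra ℂ⟦X⟧ D := (mk.comp (C (R := ℂ⟦X⟧))).toAlgebra
    have hsm : ∀ (c : ℂ⟦X⟧) (p : ℂ⟦X⟧⟦X⟧), c • mk p = mk (C c * p) := fun c p => by
      rw [Algebra.smul_def, map_mul]; rfl
    have : Module.Finite ℂ⟦X⟧ D := by
      let n := (g.map (IsLocalRing.residue ℂ⟦X⟧)).order.toNat
      let s : Set D := (fun i : ℕ => mk (X ^ i)) '' Set.Iio n
      have hs : s.Finite := (Set.finite_Iio n).image _
      refine ⟨⟨hs.toFinset, ?_⟩⟩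
      rw [Set.Finite.coe_toFinset, eq_top_iff]
      rintro d -
      obtain ⟨p, rfl⟩ := hmks d
      obtain ⟨q, r, hqr⟩ := exists_isWeierstrassDivision (f := p) hmap
      have h1 : mk p = mk (r : ℂ⟦X⟧⟦X⟧) := by
        rw [← sub_eq_zero, ← map_sub, hmk, Ideal.mem_span_singleton]
        refine ⟨q, ?_⟩
        rw [hqr.2]; ring
      rw [h1]
      have hdeg : r.natDegree < n ∨ r = 0 := by
        by_cases hr : r = 0
        · exact Or.inr hr
        · left
          have := hqr.1
          rw [Polynomial.degree_eq_natDegree hr] at this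
          exact_mod_cast this
      rcases hdeg with hdeg | rfl
      · have h5 : mk (r : ℂ⟦X⟧⟦X⟧) =
            ∑ i ∈ Finset.range n, r.coeff i • mk (X ^ i) := by
          conv_lhs => rw [r.as_sum_range' n hdeg]
          rw [← Polynomial.coeToPowerSeries.ringHom_apply, map_sum, map_sum]
          refine Finset.sum_congr rfl fun i _ => ?_
          rw [Polynomial.coeToPowerSeries.ringHom_apply, Polynomial.coe_monomial,
            hsm]
          congr 1
          rw [monomial_eq_C_mul_X_pow]
        rw [h5]
        refine Submodule.sum_mem _ fun i hi => Submodule.smul_mem _ _ (Submodule.subset_span ?_)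
        exact ⟨i, Finset.mem_range.1 hi, rfl⟩
      · simp
    have hinj : Function.Injective (algebraMap ℂ⟦X⟧ D) := by
      rw [injective_iff_map_eq_zero]
      intro x hx
      by_contra hx0
      have hx1 : (C x : ℂ⟦X⟧⟦X⟧) ∈ Ideal.span {g} := (hmk _).1 hx
      obtain ⟨n, u, rfl⟩ := IsDiscreteValuationRing.eq_unit_mul_pow_irreducible hx0
        (PowerSeries.X_prime (R := ℂ)).irreducible
      rw [map_mul, map_pow] at hx1
      rcases hgp.mem_or_mem hx1 with h6 | h6
      · exact hgp.ne_top (Ideal.eq_top_of_isUnit_mem _ h6 (u.isUnit.map C))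
      · exact hX (hgp.mem_of_pow_mem _ h6)
    have : CharZero ℂ⟦X⟧ := charZero_of_injective_ringHom (f := C (R := ℂ)) C_injective
    obtain ⟨B, _, _, φ, π, h1, h2, h3, h4⟩ := exists_normalization (A := ℂ⟦X⟧) (D := D) hinj
    refine ⟨B, inferInstance, inferInstance, φ.comp mk, π,
      ?_, ?_, h2, h3, ?_⟩
    · exact h1.comp (RingHom.Finite.of_surjective _ hmks)
    · have : mk g = 0 :=
        (hmk _).2 (Ideal.mem_span_singleton_self g)
      rw [RingHom.comp_apply, this, map_zero]
    · rw [← RingHom.comp_assoc, RingHom.coe_comp]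
      exact h4.comp hmks
end G0Aux

namespace G0Aux

theorem exists_equiv : Nonempty (MvPowerSeries (Fin 2) ℂ ≃+* PowerSeries (PowerSeries ℂ)) := by
  have e : Fin 2 ≃ Option Unit := Fintype.equivOfCardEq (by simp)
  exact ⟨((MvPowerSeries.renameEquiv ℂ e).trans
    (MvPowerSeries.optionEquivLeft Unit ℂ)).toRingEquiv⟩

theorem primes_R (g : MvPowerSeries (Fin 2) ℂ) (hg : Prime g)
    (q : Ideal (MvPowerSeries (Fin 2) ℂ)) (hq : q.IsPrime)
    (hgq : g ∈ q) : q = Ideal.span {g} ∨ q.IsMaximal := by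
  obtain ⟨e⟩ := exists_equiv
  have hg' : Prime (e g) := (MulEquiv.prime_iff e.toMulEquiv).2 hg
  have hq' : (q.comap e.symm).IsPrime := Ideal.comap_isPrime e.symm q
  rcases primes_P (e g) hg' (q.comap e.symm) hq' (by simpa using hgq) with h | h
  · left
    ext x
    have : e x ∈ q.comap e.symm ↔ e x ∈ Ideal.span {e g} := by rw [h]
    rw [Ideal.mem_comap, e.symm_apply_apply, Ideal.mem_span_singleton] at this
    rw [this, Ideal.mem_span_singleton, map_dvd_iff]
  · right
    have h2 : q = (q.comap e.symm).comap e := by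
      ext x; simp
    have : (q.comap e.symm).IsMaximal := by rw [h]; infer_instance
    rw [h2]
    exact Ideal.comap_isMaximal_of_surjective e e.surjective

theorem exists_norm_R (g : MvPowerSeries (Fin 2) ℂ) (hg : Prime g) :
    ∃ (B : Type) (_ : CommRing B) (_ : IsDomain B) (φ : MvPowerSeries (Fin 2) ℂ →+* B) (π : B),
      φ.Finite ∧ φ g = 0 ∧ π ≠ 0 ∧
      (Ideal.span {π}).IsMaximal ∧
      Function.Surjective ((Ideal.Quotient.mk (Ideal.span {π})).comp φ) := by
  obtain ⟨e⟩ := exists_equiv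
  have hg' : Prime (e g) := (MulEquiv.prime_iff e.toMulEquiv).2 hg
  obtain ⟨B, _, _, φ, π, h1, h2, h3, h4, h5⟩ := exists_norm_P (e g) hg'
  refine ⟨B, inferInstance, inferInstance, φ.comp e.toRingHom, π, ?_, h2, h3, h4, ?_⟩
  · exact h1.comp (RingHom.Finite.of_surjective _ e.surjective)
  · rw [← RingHom.comp_assoc, RingHom.coe_comp]
    exact h5.comp e.surjective

/-- vanishing of the class of the residue field -/
theorem mk_residue_zero {S : Type} [CommRing S] [IsLocalRing S] (q : Ideal S) (hq : q.IsMaximal)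
    {B : Type} [CommRing B] [IsDomain B] (ψ : S →+* B) (π : B) (hψ : ψ.Finite) (hπ : π ≠ 0)
    (hmax : (Ideal.span {π}).IsMaximal)
    (hs : Function.Surjective ((Ideal.Quotient.mk (Ideal.span {π})).comp ψ)) :
    G0.mk (FGMod.of S (S ⧸ q)) = 0 := by
  let _ : Algebra S B := ψ.toAlgebra
  have : Module.Finite S B := hψ
  let N : Submodule S B := (Ideal.span {π}).restrictScalars S
  have h1 := mk_exact' (R := S) B B (B ⧸ N) (LinearMap.mulLeft S π) N.mkQ
    (fun x y hxy => mul_left_cancel₀ hπ hxy) N.mkQ_surjective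
    (by
      rw [LinearMap.exact_iff, Submodule.ker_mkQ]
      ext x
      simp only [N, Submodule.restrictScalars_mem, Ideal.mem_span_singleton, LinearMap.mem_range,
        LinearMap.mulLeft_apply]
      exact ⟨fun ⟨c, hc⟩ => ⟨c, hc.symm⟩, fun ⟨c, hc⟩ => ⟨c, hc.symm⟩⟩)
  have h2 : G0.mk (FGMod.of S (B ⧸ N)) = 0 := by simpa using h1
  rw [← h2]
  let l : S →ₗ[S] B ⧸ N := N.mkQ.comp (Algebra.linearMap S B)
  have hl : ∀ s, l s = 0 ↔ s ∈ RingHom.ker ((Ideal.Quotient.mk (Ideal.span {π})).comp ψ) := by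
    intro s
    rw [RingHom.mem_ker, RingHom.comp_apply, Ideal.Quotient.eq_zero_iff_mem]
    exact Submodule.Quotient.mk_eq_zero N
  have hls : Function.Surjective l := by
    intro y
    obtain ⟨b, rfl⟩ := N.mkQ_surjective y
    obtain ⟨s, hs⟩ := hs (Ideal.Quotient.mk _ b)
    refine ⟨s, ?_⟩
    rw [RingHom.comp_apply, Ideal.Quotient.eq] at hs
    exact (Submodule.Quotient.eq N).2 hs
  have hk : LinearMap.ker l = q := by
    have hm : (RingHom.ker ((Ideal.Quotient.mk (Ideal.span {π})).comp ψ)).IsMaximal := by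
      let _ := Ideal.Quotient.field (Ideal.span {π})
      exact RingHom.ker_isMaximal_of_surjective _ hs
    rw [IsLocalRing.eq_maximalIdeal hq, ← IsLocalRing.eq_maximalIdeal hm]
    ext s
    exact (hl s)
  exact mk_equiv _ _ ((Submodule.quotEquivOfEq _ _ hk.symm).trans (l.quotKerEquivOfSurjective hls))

/-- additivity of cyclic modules -/
theorem mk_mul {R : Type} [CommRing R] [IsDomain R] (F g h : R) (hF : F ≠ 0)
    (hgh : g * h ∣ F) :
    G0.mk (FGMod.of (R ⧸ Ideal.span {F}) ((R ⧸ Ideal.span {F}) ⧸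
      Ideal.span {Ideal.Quotient.mk (Ideal.span {F}) (g * h)})) =
    G0.mk (FGMod.of (R ⧸ Ideal.span {F}) ((R ⧸ Ideal.span {F}) ⧸
      Ideal.span {Ideal.Quotient.mk (Ideal.span {F}) h})) +
    G0.mk (FGMod.of (R ⧸ Ideal.span {F}) ((R ⧸ Ideal.span {F}) ⧸
      Ideal.span {Ideal.Quotient.mk (Ideal.span {F}) g})) := by
  have key : ∀ d x : R, d ∣ F → (Ideal.Quotient.mk (Ideal.span {F}) x ∈
      Ideal.span {Ideal.Quotient.mk (Ideal.span {F}) d} ↔ d ∣ x) := by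
    intro d x hd
    rw [Ideal.mem_span_singleton]
    constructor
    · rintro ⟨c, hc⟩
      obtain ⟨c, rfl⟩ := Ideal.Quotient.mk_surjective c
      rw [← map_mul, Ideal.Quotient.eq, Ideal.mem_span_singleton] at hc
      have := (hd.trans hc).add (dvd_mul_right d c)
      simpa using this
    · exact fun h => map_dvd _ h
  generalize hI : Ideal.span {Ideal.Quotient.mk (Ideal.span {F}) (g * h)} = I
  generalize hJ : Ideal.span {Ideal.Quotient.mk (Ideal.span {F}) g} = J
  generalize hK : Ideal.span {Ideal.Quotient.mk (Ideal.span {F}) h} = K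
  have kI : ∀ x, Ideal.Quotient.mk (Ideal.span {F}) x ∈ I ↔ g * h ∣ x := by
    intro x; rw [← hI]; exact key _ _ hgh
  have kJ : ∀ x, Ideal.Quotient.mk (Ideal.span {F}) x ∈ J ↔ g ∣ x := by
    intro x; rw [← hJ]; exact key _ _ ((dvd_mul_right g h).trans hgh)
  have kK : ∀ x, Ideal.Quotient.mk (Ideal.span {F}) x ∈ K ↔ h ∣ x := by
    intro x; rw [← hK]; exact key _ _ ((dvd_mul_left h g).trans hgh)
  have hg0 : g ≠ 0 := by
    rintro rfl
    rw [zero_mul, zero_dvd_iff] at hgh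
    exact hF hgh
  have hmul : K ≤ Submodule.comap (LinearMap.mulLeft (R ⧸ Ideal.span {F})
      (Ideal.Quotient.mk (Ideal.span {F}) g)) I := by
    intro x hx
    obtain ⟨x, rfl⟩ := Ideal.Quotient.mk_surjective x
    rw [Submodule.mem_comap, LinearMap.mulLeft_apply, ← map_mul, kI]
    exact mul_dvd_mul_left g ((kK x).1 hx)
  have hIJ : I ≤ J := by
    intro x hx
    obtain ⟨x, rfl⟩ := Ideal.Quotient.mk_surjective x
    exact (kJ x).2 ((dvd_mul_right g h).trans ((kI x).1 hx))
  refine mk_exact' _ _ _ (Submodule.mapQ K I (LinearMap.mulLeft (R ⧸ Ideal.span {F})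
      (Ideal.Quotient.mk (Ideal.span {F}) g)) hmul) (Submodule.factor hIJ) ?_ ?_ ?_
  · rw [injective_iff_map_eq_zero]
    intro y hy
    obtain ⟨y, rfl⟩ := K.mkQ_surjective y
    obtain ⟨x, rfl⟩ := Ideal.Quotient.mk_surjective y
    have hy' : Ideal.Quotient.mk (Ideal.span {F}) (g * x) ∈ I := by
      rw [map_mul]
      exact (Submodule.Quotient.mk_eq_zero I).1 hy
    exact (Submodule.Quotient.mk_eq_zero K).2
      ((kK x).2 ((mul_dvd_mul_iff_left hg0).1 ((kI _).1 hy')))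
  · exact Submodule.factor_surjective hIJ
  · intro y
    obtain ⟨y, rfl⟩ := I.mkQ_surjective y
    obtain ⟨x, rfl⟩ := Ideal.Quotient.mk_surjective y
    constructor
    · intro hx
      have hx' : Ideal.Quotient.mk (Ideal.span {F}) x ∈ J := (Submodule.Quotient.mk_eq_zero J).1 hx
      obtain ⟨z, rfl⟩ := (kJ x).1 hx'
      exact ⟨K.mkQ (Ideal.Quotient.mk (Ideal.span {F}) z), rfl⟩
    · rintro ⟨z, hz⟩
      obtain ⟨z, rfl⟩ := K.mkQ_surjective z
      obtain ⟨z, rfl⟩ := Ideal.Quotient.mk_surjective z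
      rw [← hz]
      refine (Submodule.Quotient.mk_eq_zero J).2 ?_
      exact (kJ (g * z)).2 (dvd_mul_right g z)

/-- the class of the cyclic module `R/(d)` -/
noncomputable def cyc {R : Type} [CommRing R] (F d : R) : G0 (R ⧸ Ideal.span {F}) :=
  G0.mk (FGMod.of (R ⧸ Ideal.span {F}) ((R ⧸ Ideal.span {F}) ⧸
      Ideal.span {Ideal.Quotient.mk (Ideal.span {F}) d}))

theorem cyc_one {R : Type} [CommRing R] (F : R) : cyc F 1 = 0 := by
  unfold cyc
  have : Subsingleton ((R ⧸ Ideal.span {F}) ⧸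
      Ideal.span {Ideal.Quotient.mk (Ideal.span {F}) (1 : R)}) := by
    rw [Ideal.Quotient.subsingleton_iff, map_one, Ideal.span_singleton_one]
  exact mk_subsingleton _

theorem cyc_pow {R : Type} [CommRing R] [IsDomain R] (F g : R) (hF : F ≠ 0) (n : ℕ)
    (h : g ^ n ∣ F) : cyc F (g ^ n) = n • cyc F g := by
  induction n with
  | zero => rw [pow_zero, cyc_one, zero_smul]
  | succ n ih =>
    rw [pow_succ] at h ⊢
    have := mk_mul F (g ^ n) g hF h
    rw [succ_nsmul', ← ih ((dvd_mul_right _ _).trans h)]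
    exact this

theorem cyc_prod {R : Type} [CommRing R] [IsDomain R] (F : R) (hF : F ≠ 0) {ι : Type}
    (s : Finset ι) (f : ι → R) (a : ι → ℕ)
    (h : ∏ i ∈ s, f i ^ a i ∣ F) :
    cyc F (∏ i ∈ s, f i ^ a i) = ∑ i ∈ s, a i • cyc F (f i) := by
  classical
  induction s using Finset.induction_on with
  | empty => rw [Finset.prod_empty, Finset.sum_empty, cyc_one]
  | insert i s hi ih =>
    rw [Finset.prod_insert hi] at h ⊢
    rw [Finset.sum_insert hi, ← ih ((dvd_mul_left _ _).trans h),
      ← cyc_pow F (f i) hF _ ((dvd_mul_right _ _).trans h), add_comm]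
    exact mk_mul F _ _ hF h

theorem cyc_self {R : Type} [CommRing R] (F : R) :
    cyc F F = G0.mk (FGMod.of (R ⧸ Ideal.span {F}) (R ⧸ Ideal.span {F})) := by
  unfold cyc
  apply mk_equiv
  refine Submodule.quotEquivOfEqBot _ ?_
  rw [Ideal.span_singleton_eq_bot, Ideal.Quotient.eq_zero_iff_mem]
  exact Ideal.mem_span_singleton_self F
end G0Aux

/-- **`G₀(𝒮) ≅ ℤ^t` via lengths at the minimal primes.**
Let `𝒮 = ℂ[[x,y]]/(f)` with `f = f₁^{a₁} ⋯ f_t^{a_t}`, the `fᵢ` irreducible and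
pairwise coprime, `aᵢ ≥ 1`, and minimal primes `𝔭₁, …, 𝔭_t`.  Then the map
`G₀(𝒮) → ℤ^t` sending `[M]` to `(ℓ_{𝔭₁}(M_{𝔭₁}), …, ℓ_{𝔭_t}(M_{𝔭_t}))` is a group
isomorphism, so `G₀(𝒮) ≅ ℤ^t`.  Moreover, under this isomorphism the class `[𝒮]` maps
to `(a₁, …, a_t)`. -/
theorem g0_powerSeries_quotient_iso (t : ℕ) (f : Fin t → MvPowerSeries (Fin 2) ℂ)
    (hirr : ∀ i, Irreducible (f i)) (hcop : ∀ i j, i ≠ j → IsRelPrime (f i) (f j))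
    (a : Fin t → ℕ) (ha : ∀ i, 1 ≤ a i) (hp : ∀ i, (psPrime t f a i).IsPrime) :
    ∃ ρ : G0 (PSRing t f a) →+ (Fin t → ℤ),
      (∀ (M : FGMod (PSRing t f a)) (i : Fin t), ∃ m : ℕ,
          ρ (G0.mk M) i = (m : ℤ) ∧
          modLength (Localization (@Ideal.primeCompl _ _ (psPrime t f a i) (hp i)))
              (LocalizedModule (@Ideal.primeCompl _ _ (psPrime t f a i) (hp i))
                M.carrier) =
            ((m : ℕ∞) : WithBot ℕ∞)) ∧
      Function.Bijective ρ ∧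
      ρ (G0.mk (FGMod.of (PSRing t f a) (PSRing t f a))) = fun i : Fin t => (a i : ℤ) := by
  have hF0 : ∏ i, f i ^ a i ≠ 0 :=
    Finset.prod_ne_zero_iff.2 fun i _ => pow_ne_zero _ (hirr i).ne_zero
  have hdvd : ∀ i, f i ∣ ∏ i, f i ^ a i := fun i =>
    (dvd_pow_self (f i) (by have := ha i; omega)).trans
      (Finset.dvd_prod_of_mem (fun i => f i ^ a i) (Finset.mem_univ i))
  have hcomap : ∀ i, (psPrime t f a i).comap (Ideal.Quotient.mk (psIdeal t f a)) =
      Ideal.span {f i} := by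
    intro i
    ext x
    rw [Ideal.mem_comap, psPrime, Ideal.mem_span_singleton, Ideal.mem_span_singleton]
    constructor
    · rintro ⟨c, hc⟩
      obtain ⟨c, rfl⟩ := Ideal.Quotient.mk_surjective c
      rw [← map_mul, Ideal.Quotient.eq, psIdeal, Ideal.mem_span_singleton] at hc
      have := ((hdvd i).trans hc).add (dvd_mul_right (f i) c)
      simpa using this
    · exact fun h => map_dvd _ h
  have hprime : ∀ i, Prime (f i) := by
    intro i
    rw [← Ideal.span_singleton_prime (hirr i).ne_zero, ← hcomap i]
    have := hp i
    exact Ideal.comap_isPrime _ _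
  have hdd : ∀ i j, f i ∣ f j → i = j := by
    intro i j h
    by_contra hij
    exact (hirr i).not_isUnit (hcop i j hij dvd_rfl h)
  have hsurj : Function.Surjective (Ideal.Quotient.mk (psIdeal t f a)) :=
    Ideal.Quotient.mk_surjective
  have hcontains : ∀ q : Ideal (PSRing t f a), q.IsPrime →
      ∃ i, f i ∈ q.comap (Ideal.Quotient.mk (psIdeal t f a)) := by
    intro q hq
    have hq' : (q.comap (Ideal.Quotient.mk (psIdeal t f a))).IsPrime := Ideal.comap_isPrime _ _
    have h1 : ∏ i, f i ^ a i ∈ q.comap (Ideal.Quotient.mk (psIdeal t f a)) := by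
      rw [Ideal.mem_comap, Ideal.Quotient.eq_zero_iff_mem.2
        (show ∏ i, f i ^ a i ∈ psIdeal t f a from Ideal.mem_span_singleton_self _)]
      exact q.zero_mem
    obtain ⟨i, -, hi⟩ := hq'.prod_mem_iff.1 h1
    exact ⟨i, hq'.mem_of_pow_mem _ hi⟩
  obtain ⟨ρ, h1, h2, h3⟩ := G0Aux.main_abstract t (psPrime t f a) hp
    (by
      intro i q hq hle
      obtain ⟨j, hj⟩ := hcontains q hq
      have h5 : f j ∈ (psPrime t f a i).comap (Ideal.Quotient.mk (psIdeal t f a)) := hle hj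
      rw [hcomap, Ideal.mem_span_singleton] at h5
      obtain rfl := hdd _ _ h5
      refine le_antisymm hle ?_
      rw [psPrime, Ideal.span_singleton_le_iff_mem]
      exact hj)
    (by
      intro i j hij
      have h5 : f j ∈ (psPrime t f a i).comap (Ideal.Quotient.mk (psIdeal t f a)) := by
        rw [hij, hcomap]
        exact Ideal.mem_span_singleton_self _
      rw [hcomap, Ideal.mem_span_singleton] at h5
      exact hdd _ _ h5)
    (by
      intro q hq
      obtain ⟨i, hi⟩ := hcontains q hq
      have hq' : (q.comap (Ideal.Quotient.mk (psIdeal t f a))).IsPrime := Ideal.comap_isPrime _ _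
      rcases G0Aux.primes_R (f i) (hprime i) _ hq' hi with h5 | h5
      · left
        refine ⟨i, ?_⟩
        rw [← hcomap i] at h5
        exact Ideal.comap_injective_of_surjective _ hsurj h5
      · right
        have hqm : q.IsMaximal := by
          have := Ideal.map_eq_top_or_isMaximal_of_surjective
            (Ideal.Quotient.mk (psIdeal t f a)) hsurj h5
          rw [Ideal.map_comap_of_surjective _ hsurj] at this
          exact this.resolve_left hq.ne_top
        have : Nontrivial (PSRing t f a) := (Ideal.Quotient.mk q).domain_nontrivial
        have : IsLocalRing (PSRing t f a) := IsLocalRing.of_surjective' _ hsurj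
        obtain ⟨B, _, _, φ, π, k1, k2, k3, k4, k5⟩ := G0Aux.exists_norm_R (f i) (hprime i)
        have hφ : ∀ x ∈ psIdeal t f a, φ x = 0 := by
          intro x hx
          rw [psIdeal, Ideal.mem_span_singleton] at hx
          have := map_dvd φ ((hdvd i).trans hx)
          rwa [k2, zero_dvd_iff] at this
        have hcomp : (Ideal.Quotient.lift (psIdeal t f a) φ hφ).comp
            (Ideal.Quotient.mk (psIdeal t f a)) = φ := Ideal.Quotient.lift_comp_mk _ _ _
        refine G0Aux.mk_residue_zero q hqm (Ideal.Quotient.lift (psIdeal t f a) φ hφ) π ?_ k3 k4 ?_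
        · rw [← hcomp] at k1
          exact RingHom.Finite.of_comp_finite k1
        · rw [← hcomp, ← RingHom.comp_assoc, RingHom.coe_comp] at k5
          exact Function.Surjective.of_comp k5)
  refine ⟨ρ, h1, h2, ?_⟩
  have : IsDomain (MvPowerSeries (Fin 2) ℂ) := NoZeroDivisors.to_isDomain _
  have h6 : G0.mk (FGMod.of (PSRing t f a) (PSRing t f a)) =
      ∑ i, a i • G0.mk (FGMod.of (PSRing t f a) (PSRing t f a ⧸ psPrime t f a i)) :=
    (G0Aux.cyc_self _).symm.trans (G0Aux.cyc_prod _ hF0 Finset.univ f a dvd_rfl)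
  rw [h6, map_sum]
  simp only [map_nsmul, h3]
  funext j
  rw [Finset.sum_apply, Finset.sum_eq_single j]
  · simp
  · intro i _ hij
    simp [Pi.single_eq_of_ne hij.symm]
  · simp
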